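/- For r ≥ 2, each subgraph B_k of WB(r) (the graph induced by four consecutive columns 4(k-1)+1,…,4(k-1)+4) is planar. -/

import Mathlib

/-- `w` and `w'` differ in precisely the `n`-th bit. -/
def differOnly {r : ℕ} (w w' : Fin r → Bool) (n : ℕ) : Prop :=
  ∀ t : Fin r, ((t : ℕ) = n → w t ≠ w' t) ∧ ((t : ℕ) ≠ n → w t = w' t)

/-- The `r`-dimensional butterfly network `BF(r)`: vertices are pairs `[w, i]` with
`w` an `r`-bit string and `0 ≤ i ≤ r`; `[w,i]` and `[w',i']` are adjacent iff
`i' = i + 1` and either `w = w'` or `w, w'` differ in precisely the `i`-th bit. -/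
def butterfly (r : ℕ) : SimpleGraph ((Fin r → Bool) × Fin (r + 1)) :=
  SimpleGraph.fromRel (fun u v =>
    (v.2 : ℕ) = (u.2 : ℕ) + 1 ∧ (u.1 = v.1 ∨ differOnly u.1 v.1 (u.2 : ℕ)))

/-- The `r`-dimensional wrapped butterfly `WB(r)`: vertices are pairs `(i, w)` with
`i ∈ ℤ/rℤ` (modelled as `Fin r` with wrap-around addition) and `w` an `r`-bit string;
`(i, w)` is adjacent to `(i+1, w')` iff `w = w'` or `w, w'` differ exactly in bit `i`. -/
def wrappedButterfly (r : ℕ) : SimpleGraph (Fin r × (Fin r → Bool)) :=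
  SimpleGraph.fromRel (fun u v =>
    (v.1 : ℕ) = ((u.1 : ℕ) + 1) % r ∧ (u.2 = v.2 ∨ differOnly u.2 v.2 (u.1 : ℕ)))

/-- The row number of a row string `w` (so the left-to-right label of the column of `w`
is `rowNum w + 1`). -/
def rowNum {r : ℕ} (w : Fin r → Bool) : ℕ :=
  ∑ t : Fin r, if w t then 2 ^ (t : ℕ) else 0

/-- The vertex set of the subgraph `B_k` of `WB(r)`: the four consecutive columns
`4(k-1)+1, …, 4(k-1)+4` in the left-to-right labeling. -/
def Bblock (r k : ℕ) : Set (Fin r × (Fin r → Bool)) :=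
  {v | ∃ j, 1 ≤ j ∧ j ≤ 4 ∧ rowNum v.2 + 1 = 4 * (k - 1) + j}

/-- A plane embedding of a simple graph `G`: vertices are mapped injectively to points
of the plane, each edge is realized as a simple (injective continuous) arc between the
images of its endpoints, and two arcs realizing distinct edges meet only at images of
common endpoints. -/
structure PlaneEmbedding {V : Type*} (G : SimpleGraph V) where
  vert : V → ℝ × ℝ
  vert_inj : Function.Injective vert
  arc : ∀ ⦃u v : V⦄, G.Adj u v → C(unitInterval, ℝ × ℝ)
  arc_inj : ∀ ⦃u v : V⦄ (h : G.Adj u v), Function.Injective (arc h)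
  arc_zero : ∀ ⦃u v : V⦄ (h : G.Adj u v), arc h 0 = vert u
  arc_one : ∀ ⦃u v : V⦄ (h : G.Adj u v), arc h 1 = vert v
  arc_meet : ∀ ⦃u v u' v' : V⦄ (h : G.Adj u v) (h' : G.Adj u' v'),
    s(u, v) ≠ s(u', v') →
      Set.range (arc h) ∩ Set.range (arc h') ⊆
        ({vert u, vert v} : Set (ℝ × ℝ)) ∩ {vert u', vert v'}

/-- A graph is planar if it admits a plane embedding. -/
def IsPlanar {V : Type*} (G : SimpleGraph V) : Prop :=
  Nonempty (PlaneEmbedding G)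

section PlaneDrawings

/-- A graph is planar if its edges are the pieces obtained by cutting curves that pairwise
meet only at common ends, the curve `γ c` being cut into `n c` equal parameter intervals. -/
theorem isPlanar_of_subdivided_curves {V C : Type*} {G : SimpleGraph V}
    (vert : V → ℝ × ℝ) (vert_inj : Function.Injective vert)
    (γ : C → ℝ → ℝ × ℝ) (γ_cont : ∀ c, Continuous (γ c))
    (γ_inj : ∀ c, Function.Injective (γ c))
    (γ_meet : ∀ c c', c ≠ c' → ∀ s ∈ Set.Icc (0 : ℝ) 1, ∀ t ∈ Set.Icc (0 : ℝ) 1,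
      γ c s = γ c' t → (s = 0 ∨ s = 1) ∧ (t = 0 ∨ t = 1))
    (n : C → ℕ)
    (edge : ∀ u v, G.Adj u v → ∃ c, ∃ m < n c,
      s(vert u, vert v) = s(γ c (m / n c), γ c ((m + 1) / n c))) :
    IsPlanar G := by
  have param : ∀ ⦃u v : V⦄, G.Adj u v → ∃ (c : C) (m : ℕ) (s t : ℝ), m < n c ∧
      (s = m / n c ∧ t = (m + 1) / n c ∨ s = (m + 1) / n c ∧ t = m / n c) ∧
      vert u = γ c s ∧ vert v = γ c t := by
    intro u v h
    obtain ⟨c, m, hm, he⟩ := edge u v h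
    rcases Sym2.eq_iff.1 he with ⟨h1, h2⟩ | ⟨h1, h2⟩
    · exact ⟨c, m, _, _, hm, .inl ⟨rfl, rfl⟩, h1, h2⟩
    · exact ⟨c, m, _, _, hm, .inr ⟨rfl, rfl⟩, h1, h2⟩
  choose c m s t hm hst hu hv using param
  have between : ∀ ⦃u v : V⦄ (h : G.Adj u v) (x : unitInterval),
      (m h / n (c h) : ℝ) ≤ s h + x * (t h - s h) ∧
        s h + x * (t h - s h) ≤ (m h + 1) / n (c h) := by
    intro u v h x
    have hle : (m h / n (c h) : ℝ) ≤ (m h + 1) / n (c h) := by gcongr; linarith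
    have hx0 := x.2.1
    have hx1 := x.2.2
    rcases hst h with ⟨h1, h2⟩ | ⟨h1, h2⟩ <;> rw [h1, h2] <;> constructor <;> nlinarith
  have n_pos : ∀ ⦃u v : V⦄ (h : G.Adj u v), (0 : ℝ) < n (c h) := fun u v h => by
    exact_mod_cast (Nat.zero_le _).trans_lt (hm h)
  have bounds : ∀ ⦃u v : V⦄ (h : G.Adj u v),
      (0 : ℝ) ≤ m h / n (c h) ∧ ((m h : ℝ) + 1) / n (c h) ≤ 1 := by
    intro u v h
    refine ⟨by positivity, ?_⟩
    rw [div_le_one (n_pos h)]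
    exact_mod_cast hm h
  have at_end : ∀ ⦃u v : V⦄ (h : G.Adj u v) (p : ℝ),
      p = m h / n (c h) ∨ p = (m h + 1) / n (c h) →
        γ (c h) p ∈ ({vert u, vert v} : Set (ℝ × ℝ)) := by
    intro u v h p hp
    rw [hu h, hv h]
    rcases hst h with ⟨h1, h2⟩ | ⟨h1, h2⟩ <;> rcases hp with rfl | rfl <;> simp [h1, h2]
  have at_limit : ∀ ⦃u v : V⦄ (h : G.Adj u v) (x : unitInterval),
      (s h + x * (t h - s h) = 0 ∨ s h + x * (t h - s h) = 1) →
        γ (c h) (s h + x * (t h - s h)) ∈ ({vert u, vert v} : Set (ℝ × ℝ)) := by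
    intro u v h x hx
    have hb := between h x
    have hc := bounds h
    refine at_end h _ (hx.imp (fun h0 => ?_) fun h1 => ?_) <;> linarith
  refine ⟨⟨vert, vert_inj, fun u v h => ⟨fun x => γ (c h) (s h + x * (t h - s h)),
    (γ_cont _).comp (by fun_prop)⟩, ?_, ?_, ?_, ?_⟩⟩
  · intro u v h x y hxy
    have hxy' := γ_inj _ hxy
    have hne : t h - s h ≠ 0 := by
      intro h0
      have : vert u = vert v := by rw [hu h, hv h, sub_eq_zero.1 h0]
      exact h.ne (vert_inj this)
    exact Subtype.ext (mul_right_cancel₀ hne (add_left_cancel hxy'))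
  · intro u v h
    simp [hu h]
  · intro u v h
    simp [hv h]
  · rintro u v u' v' h h' hne _ ⟨⟨x, rfl⟩, ⟨y, hy⟩⟩
    have hy : γ (c h') (s h' + y * (t h' - s h')) = γ (c h) (s h + x * (t h - s h)) := hy
    change γ (c h) (s h + x * (t h - s h)) ∈ _
    have hx_bd := between h x
    have hy_bd := between h' y
    by_cases hc : c h = c h'
    · have hp : s h' + y * (t h' - s h') = s h + x * (t h - s h) := by
        rw [← hc] at hy
        exact γ_inj _ hy
      have hm_ne : m h ≠ m h' := by
        intro hmm
        refine hne ((Sym2.map.injective vert_inj) ?_)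
        simp only [Sym2.map_mk, hu h, hv h, hu h', hv h', ← hc]
        rcases hst h with ⟨h1, h2⟩ | ⟨h1, h2⟩ <;> rcases hst h' with ⟨h3, h4⟩ | ⟨h3, h4⟩ <;>
          rw [h1, h2, h3, h4, ← hc, ← hmm]
        all_goals exact Sym2.eq_swap
      have hends : (s h + x * (t h - s h) = m h / n (c h) ∨
          s h + x * (t h - s h) = (m h + 1) / n (c h)) ∧
          (s h + x * (t h - s h) = m h' / n (c h') ∨
          s h + x * (t h - s h) = (m h' + 1) / n (c h')) := by
        rw [hp] at hy_bd
        rw [← hc] at hy_bd ⊢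
        have hn := n_pos h
        rcases Nat.lt_or_gt_of_ne hm_ne with hlt | hlt
        · have : ((m h : ℝ) + 1) / n (c h) ≤ m h' / n (c h) := by
            gcongr
            exact_mod_cast hlt
          exact ⟨.inr (by linarith), .inl (by linarith)⟩
        · have : ((m h' : ℝ) + 1) / n (c h) ≤ m h / n (c h) := by
            gcongr
            exact_mod_cast hlt
          exact ⟨.inl (by linarith), .inr (by linarith)⟩
      refine ⟨at_end h _ hends.1, ?_⟩
      rw [hc]
      exact at_end h' _ hends.2
    · have hb := bounds h
      have hb' := bounds h'
      obtain ⟨hx01, hy01⟩ := γ_meet _ _ hc _ ⟨by linarith, by linarith⟩ _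
        ⟨by linarith, by linarith⟩ hy.symm
      refine ⟨at_limit h x hx01, ?_⟩
      rw [← hy]
      exact at_limit h' y hy01

/-- The point of parameter `t` on the line through the end points of a lattice segment. -/
def segPoint (e : (ℤ × ℤ) × (ℤ × ℤ)) (t : ℝ) : ℝ × ℝ :=
  ((1 - t) * e.1.1 + t * e.2.1, (1 - t) * e.1.2 + t * e.2.2)

/-- Twice the signed area of the triangle spanned by a lattice segment and a lattice point. -/
def orient (e : (ℤ × ℤ) × (ℤ × ℤ)) (z : ℤ × ℤ) : ℤ :=
  (e.2.1 - e.1.1) * (z.2 - e.1.2) - (e.2.2 - e.1.2) * (z.1 - e.1.1)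

/-- An orientation test ensuring that two lattice segments meet at common ends only. -/
def MeetAtEnds (e f : (ℤ × ℤ) × (ℤ × ℤ)) : Prop :=
  0 < orient e f.1 * orient e f.2 ∨ 0 < orient f e.1 * orient f e.2 ∨
    (orient e f.1 * orient e f.2 = 0 ∧ orient e f.1 ≠ orient e f.2) ∧
      (orient f e.1 * orient f e.2 = 0 ∧ orient f e.1 ≠ orient f e.2)

instance (e f : (ℤ × ℤ) × (ℤ × ℤ)) : Decidable (MeetAtEnds e f) := by
  unfold MeetAtEnds
  infer_instance

theorem continuous_segPoint (e : (ℤ × ℤ) × (ℤ × ℤ)) : Continuous (segPoint e) := by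
  unfold segPoint
  fun_prop

theorem segPoint_injective {e : (ℤ × ℤ) × (ℤ × ℤ)} (he : e.1 ≠ e.2) :
    Function.Injective (segPoint e) := by
  intro s t hst
  simp only [segPoint, Prod.mk.injEq] at hst
  by_contra hne
  have hne : s - t ≠ 0 := sub_ne_zero.2 hne
  refine he (Prod.ext ?_ ?_)
  · have : (s - t) * ((e.1.1 : ℝ) - e.2.1) = 0 := by linarith
    exact_mod_cast sub_eq_zero.1 ((mul_eq_zero.1 this).resolve_left hne)
  · have : (s - t) * ((e.1.2 : ℝ) - e.2.2) = 0 := by linarith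
    exact_mod_cast sub_eq_zero.1 ((mul_eq_zero.1 this).resolve_left hne)

theorem segPoint_orient {e f : (ℤ × ℤ) × (ℤ × ℤ)} {s t : ℝ} (h : segPoint e s = segPoint f t) :
    (1 - t) * orient e f.1 + t * orient e f.2 = 0 := by
  simp only [segPoint, Prod.mk.injEq] at h
  simp only [orient]
  push_cast
  linear_combination ((e.2.2 : ℝ) - e.1.2) * h.1 - ((e.2.1 : ℝ) - e.1.1) * h.2

theorem not_combination_eq_zero {a b : ℤ} (hab : 0 < a * b) {t : ℝ} (ht : t ∈ Set.Icc (0 : ℝ) 1) :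
    (1 - t) * a + t * b ≠ 0 := by
  intro h
  have hab : (0 : ℝ) < a * b := by exact_mod_cast hab
  have ha : (0 : ℝ) < (a : ℝ) ^ 2 := by
    have : (a : ℝ) ≠ 0 := by rintro h0; simp [h0] at hab
    positivity
  have h2 : (1 - t) * (a : ℝ) ^ 2 + t * (a * b) = 0 := by linear_combination (a : ℝ) * h
  obtain ⟨h0, h1⟩ := ht
  rcases h0.eq_or_lt with rfl | h0
  · linarith
  · nlinarith [mul_pos h0 hab, mul_nonneg (sub_nonneg.2 h1) ha.le]

theorem eq_zero_or_one_of_combination {a b : ℤ} (hab : a * b = 0) (hne : a ≠ b) {t : ℝ}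
    (h : (1 - t) * a + t * b = 0) : t = 0 ∨ t = 1 := by
  rcases mul_eq_zero.1 hab with rfl | rfl
  · have : (b : ℝ) ≠ 0 := by exact_mod_cast hne.symm
    left
    simpa [this] using h
  · have : (a : ℝ) ≠ 0 := by exact_mod_cast hne
    right
    have : 1 - t = 0 := by simpa [this] using h
    linarith

theorem MeetAtEnds.eq_zero_or_one {e f : (ℤ × ℤ) × (ℤ × ℤ)} (hef : MeetAtEnds e f) {s t : ℝ}
    (hs : s ∈ Set.Icc (0 : ℝ) 1) (ht : t ∈ Set.Icc (0 : ℝ) 1) (h : segPoint e s = segPoint f t) :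
    (s = 0 ∨ s = 1) ∧ (t = 0 ∨ t = 1) := by
  have hst := segPoint_orient h
  have hts := segPoint_orient h.symm
  rcases hef with hpos | hpos | ⟨⟨h1, h2⟩, h3, h4⟩
  · exact absurd hst (not_combination_eq_zero hpos ht)
  · exact absurd hts (not_combination_eq_zero hpos hs)
  · exact ⟨eq_zero_or_one_of_combination h3 h4 hts, eq_zero_or_one_of_combination h1 h2 hst⟩

/-- A graph is planar if it is drawn with edges the pieces of equally subdivided
lattice segments that meet at common ends only. -/
theorem isPlanar_of_subdivided_segments {V C : Type*} {G : SimpleGraph V}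
    (vert : V → ℝ × ℝ) (vert_inj : Function.Injective vert)
    (seg : C → (ℤ × ℤ) × (ℤ × ℤ)) (seg_ne : ∀ c, (seg c).1 ≠ (seg c).2)
    (seg_meet : ∀ c c', c ≠ c' → MeetAtEnds (seg c) (seg c')) (n : C → ℕ)
    (edge : ∀ u v, G.Adj u v → ∃ c, ∃ m < n c,
      s(vert u, vert v) = s(segPoint (seg c) (m / n c), segPoint (seg c) ((m + 1) / n c))) :
    IsPlanar G :=
  isPlanar_of_subdivided_curves vert vert_inj (fun c => segPoint (seg c))
    (fun _ => continuous_segPoint _) (fun c => segPoint_injective (seg_ne c))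
    (fun c c' hc _ hs _ ht h => (seg_meet c c' hc).eq_zero_or_one hs ht h) n edge

end PlaneDrawings

section Rows

theorem rowNum_succ {n : ℕ} (w : Fin (n + 1) → Bool) :
    rowNum w = (w 0).toNat + 2 * rowNum (fun t => w t.succ) := by
  simp only [rowNum, Fin.sum_univ_succ, Finset.mul_sum]
  congr 1
  · cases w 0 <;> simp
  · refine Finset.sum_congr rfl fun t _ => ?_
    split_ifs <;> simp [pow_succ, mul_comm]

theorem rowNum_injective : ∀ n : ℕ, Function.Injective (rowNum (r := n))
  | 0, _, _, _ => Subsingleton.elim _ _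
  | n + 1, w, w', h => by
    rw [rowNum_succ, rowNum_succ] at h
    have hlt := Bool.toNat_lt (w 0)
    have hlt' := Bool.toNat_lt (w' 0)
    have hnat : (w 0).toNat = (w' 0).toNat := by omega
    have h0 : w 0 = w' 0 := by
      revert hnat
      cases w 0 <;> cases w' 0 <;> simp
    have htail := rowNum_injective n (show rowNum (fun t => w t.succ) =
      rowNum (fun t => w' t.succ) by omega)
    exact funext (Fin.cases h0 fun t => congrFun htail t)

/-- Within a block, a row is determined by its two lowest bits. -/
theorem Bblock_row_ext {n k : ℕ} {u v : Fin (n + 2) × (Fin (n + 2) → Bool)}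
    (hu : u ∈ Bblock (n + 2) k) (hv : v ∈ Bblock (n + 2) k)
    (h0 : u.2 0 = v.2 0) (h1 : u.2 1 = v.2 1) : u.2 = v.2 := by
  obtain ⟨i, _, _, hi⟩ := hu
  obtain ⟨j, _, _, hj⟩ := hv
  apply rowNum_injective
  simp only [rowNum_succ, Fin.succ_zero_eq_one, h0, h1] at hi hj ⊢
  omega

theorem wrappedButterfly_adj_cases {n : ℕ} {u v : Fin (n + 2) × (Fin (n + 2) → Bool)}
    (h : (v.1 : ℕ) = ((u.1 : ℕ) + 1) % (n + 2) ∧ (u.2 = v.2 ∨ differOnly u.2 v.2 (u.1 : ℕ))) :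
    (u.1 : ℕ) = 0 ∧ (v.1 : ℕ) = 1 ∧ u.2 1 = v.2 1 ∨
    (u.1 : ℕ) = 1 ∧ (v.1 : ℕ) = 2 % (n + 2) ∧ u.2 0 = v.2 0 ∨
    2 ≤ (u.1 : ℕ) ∧ (v.1 : ℕ) = ((u.1 : ℕ) + 1) % (n + 2) ∧ u.2 0 = v.2 0 ∧ u.2 1 = v.2 1 := by
  obtain ⟨hi, hw⟩ := h
  have bit : ∀ t : Fin (n + 2), (t : ℕ) ≠ u.1 → u.2 t = v.2 t := fun t ht =>
    hw.elim (fun h => congrFun h t) fun h => (h t).2 ht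
  rcases Nat.lt_or_ge (u.1 : ℕ) 2 with h2 | h2
  · rcases (by omega : (u.1 : ℕ) = 0 ∨ (u.1 : ℕ) = 1) with h | h
    · refine .inl ⟨h, ?_, bit 1 (by simp [h])⟩
      rw [hi, h]
      exact Nat.mod_eq_of_lt (by omega)
    · exact .inr (.inl ⟨h, by rw [hi, h], bit 0 (by simp [h])⟩)
  · exact .inr (.inr ⟨h2, hi, bit 0 (by simp; omega), bit 1 (by simp; omega)⟩)

/-- A criterion for the planarity of `B_k` in terms of a drawing of its levels. -/
theorem Bblock_planar_of_drawing {n k : ℕ} {C : Type*} (pos : ℕ → Bool → Bool → ℝ × ℝ)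
    (pos_inj : ∀ i a b i' a' b', i < n + 2 → i' < n + 2 →
      pos i a b = pos i' a' b' → i = i' ∧ a = a' ∧ b = b')
    (seg : C → (ℤ × ℤ) × (ℤ × ℤ)) (seg_ne : ∀ c, (seg c).1 ≠ (seg c).2)
    (seg_meet : ∀ c c', c ≠ c' → MeetAtEnds (seg c) (seg c')) (parts : C → ℕ)
    (edge : ∀ i a b j a' b', i < n + 2 →
      (i = 0 ∧ j = 1 ∧ b = b' ∨ i = 1 ∧ j = 2 % (n + 2) ∧ a = a' ∨
        2 ≤ i ∧ j = (i + 1) % (n + 2) ∧ a = a' ∧ b = b') →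
      ∃ c, ∃ m < parts c, s(pos i a b, pos j a' b') =
        s(segPoint (seg c) (m / parts c), segPoint (seg c) ((m + 1) / parts c))) :
    IsPlanar ((wrappedButterfly (n + 2)).induce (Bblock (n + 2) k)) := by
  refine isPlanar_of_subdivided_segments (fun v => pos v.1.1 (v.1.2 0) (v.1.2 1)) ?_
    seg seg_ne seg_meet parts ?_
  · intro u v h
    obtain ⟨hi, h0, h1⟩ := pos_inj _ _ _ _ _ _ u.1.1.2 v.1.1.2 h
    exact Subtype.ext (Prod.ext (Fin.ext hi) (Bblock_row_ext u.2 v.2 h0 h1))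
  · intro u v h
    have h : (wrappedButterfly (n + 2)).Adj u v := h
    rcases (SimpleGraph.fromRel_adj _ _ _).1 h with ⟨-, h | h⟩
    · exact edge _ _ _ _ _ _ u.1.1.2 (wrappedButterfly_adj_cases h)
    · rw [Sym2.eq_swap]
      exact edge _ _ _ _ _ _ v.1.1.2 (wrappedButterfly_adj_cases h)

end Rows

section Drawings

/-- The sign attached to a bit. -/
def bitSign (b : Bool) : ℤ := if b then 1 else -1

/-- The position of the level-one vertex with lowest bits `a`, `b`. -/
def levelOnePos (a b : Bool) : ℤ × ℤ := (2 * bitSign b, -2 * bitSign a)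

/-- The position of the level-zero vertex with lowest bits `a`, `b` in the drawing
of a block of `WB(2)`. -/
def cubePos (a b : Bool) : ℤ × ℤ :=
  if a = b then (bitSign b, 0) else (6 * bitSign b, -4 * bitSign a)

/-- The twelve segments of the drawing of a block of `WB(2)`, which is a cube. -/
def cubeSeg : Bool × Bool × Option Bool → (ℤ × ℤ) × (ℤ × ℤ)
  | (a, b, none) => (cubePos a b, levelOnePos a b)
  | (a, b, some false) => (cubePos a b, levelOnePos (!a) b)
  | (a, b, some true) => (cubePos a b, levelOnePos a (!b))

/-- The position of the level-zero vertex with lowest bits `a`, `b` in the drawing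
of a block of `WB(r)`, `3 ≤ r`. -/
def levelZeroPos (a b : Bool) : ℤ × ℤ := (if a = b then bitSign b else 6 * bitSign b, 0)

/-- The position of the level-two vertex with lowest bits `a`, `b` in the drawing
of a block of `WB(r)`, `3 ≤ r`. -/
def levelTwoPos (a b : Bool) : ℤ × ℤ := (0, if a = b then -bitSign a else -6 * bitSign a)

/-- The twenty segments of the drawing of a block of `WB(r)`, `3 ≤ r`. The segments with
index `(a, b, none)` carry the levels `2, …, r - 1, 0` of a column. -/
def necklaceSeg : Bool × Bool × Option (Bool × Bool) → (ℤ × ℤ) × (ℤ × ℤ)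
  | (a, b, none) => (levelTwoPos a b, levelZeroPos a b)
  | (a, b, some (false, a')) => (levelZeroPos a b, levelOnePos a' b)
  | (a, b, some (true, b')) => (levelOnePos a b, levelTwoPos a b')

theorem cubeSeg_meet : ∀ c c', c ≠ c' → MeetAtEnds (cubeSeg c) (cubeSeg c') := by
  decide

theorem necklaceSeg_meet :
    ∀ c c', c ≠ c' → MeetAtEnds (necklaceSeg c) (necklaceSeg c') := by
  decide

theorem segPoint_zero (e : (ℤ × ℤ) × (ℤ × ℤ)) : segPoint e 0 = ((e.1.1 : ℝ), (e.1.2 : ℝ)) := by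
  simp [segPoint]

theorem segPoint_one (e : (ℤ × ℤ) × (ℤ × ℤ)) : segPoint e 1 = ((e.2.1 : ℝ), (e.2.2 : ℝ)) := by
  simp [segPoint]

/-- A vertex of the drawing of a block of `WB(2)`. -/
def cubeVert (i : ℕ) (a b : Bool) : ℤ × ℤ := if i = 0 then cubePos a b else levelOnePos a b

theorem Bblock_two_planar (k : ℕ) :
    IsPlanar ((wrappedButterfly 2).induce (Bblock 2 k)) := by
  refine Bblock_planar_of_drawing (n := 0)
    (fun i a b => (((cubeVert i a b).1 : ℝ), ((cubeVert i a b).2 : ℝ))) ?_ cubeSeg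
    (by decide) cubeSeg_meet (fun _ => 1) ?_
  · intro i a b i' a' b' hi hi' h
    have h' : cubeVert i a b = cubeVert i' a' b' := by
      simp only [Prod.mk.injEq, Int.cast_inj] at h
      exact Prod.ext h.1 h.2
    clear h
    interval_cases i <;> interval_cases i' <;> revert a b a' b' <;> decide
  · intro i a b j a' b' hi h
    simp only [Nat.cast_one, Nat.lt_one_iff, exists_eq_left, Nat.cast_zero, zero_add,
      div_one, segPoint_zero, segPoint_one]
    rcases h with ⟨rfl, rfl, rfl⟩ | ⟨rfl, rfl, rfl⟩ | ⟨h, -⟩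
    · by_cases ha : a' = a
      · exact ⟨(a, b, none), by subst ha; rfl⟩
      · obtain rfl : a' = !a := by revert a a'; decide
        exact ⟨(a, b, some false), rfl⟩
    · by_cases hb : b' = b
      · exact ⟨(a, b, none), by subst hb; exact Sym2.eq_swap⟩
      · obtain rfl : b = !b' := by revert b b'; decide
        exact ⟨(a, b', some true), Sym2.eq_swap⟩
    · omega

/-- The drawing of the vertices of a block of `WB(n + 3)`. -/
noncomputable def necklaceVert (n i : ℕ) (a b : Bool) : ℝ × ℝ :=
  if i = 1 then ((levelOnePos a b).1, (levelOnePos a b).2)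
  else segPoint (necklaceSeg (a, b, none))
    (((if i = 0 then n + 1 else i - 2 : ℕ) : ℝ) / (n + 1 : ℕ))

theorem segPoint_column_injective {a b a' b' : Bool} {s t : ℝ} (hs : s ∈ Set.Icc (0 : ℝ) 1)
    (ht : t ∈ Set.Icc (0 : ℝ) 1)
    (h : segPoint (necklaceSeg (a, b, none)) s = segPoint (necklaceSeg (a', b', none)) t) :
    a = a' ∧ b = b' ∧ s = t := by
  obtain ⟨hs0, hs1⟩ := hs
  obtain ⟨ht0, ht1⟩ := ht
  have hne : ∀ c, (necklaceSeg c).1 ≠ (necklaceSeg c).2 := by decide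
  by_cases hab : a = a' ∧ b = b'
  · obtain ⟨rfl, rfl⟩ := hab
    exact ⟨rfl, rfl, segPoint_injective (hne _) h⟩
  · exfalso
    cases a <;> cases b <;> cases a' <;> cases b' <;>
      simp [segPoint, necklaceSeg, levelTwoPos, levelZeroPos, bitSign] at h hab <;>
      linarith [h.1, h.2]

theorem levelOnePos_not_mem_column {a b a' b' : Bool} {t : ℝ} (ht : t ∈ Set.Icc (0 : ℝ) 1) :
    (((levelOnePos a b).1 : ℝ), ((levelOnePos a b).2 : ℝ)) ≠
      segPoint (necklaceSeg (a', b', none)) t := by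
  obtain ⟨h0, h1⟩ := ht
  intro h
  cases a <;> cases b <;> cases a' <;> cases b' <;>
    simp [segPoint, necklaceSeg, levelTwoPos, levelZeroPos, levelOnePos, bitSign] at h <;>
    linarith [h.1, h.2]

theorem necklaceVert_injective {n i i' : ℕ} {a b a' b' : Bool} (hi : i < n + 3)
    (hi' : i' < n + 3) (h : necklaceVert n i a b = necklaceVert n i' a' b') :
    i = i' ∧ a = a' ∧ b = b' := by
  have mem : ∀ j < n + 3,
      ((if j = 0 then n + 1 else j - 2 : ℕ) : ℝ) / (n + 1 : ℕ) ∈ Set.Icc (0 : ℝ) 1 := by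
    intro j hj
    refine ⟨by positivity, (div_le_one (by positivity)).2 (Nat.cast_le.2 ?_)⟩
    split_ifs <;> omega
  unfold necklaceVert at h
  by_cases h1 : i = 1 <;> by_cases h1' : i' = 1
  · rw [if_pos h1, if_pos h1'] at h
    simp only [Prod.mk.injEq, Int.cast_inj] at h
    refine ⟨h1.trans h1'.symm, ?_⟩
    clear h1 h1'
    revert a b a' b'
    decide
  · rw [if_pos h1, if_neg h1'] at h
    exact absurd h (levelOnePos_not_mem_column (mem i' hi'))
  · rw [if_neg h1, if_pos h1'] at h
    exact absurd h.symm (levelOnePos_not_mem_column (mem i hi))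
  · rw [if_neg h1, if_neg h1'] at h
    obtain ⟨ha, hb, hst⟩ := segPoint_column_injective (mem i hi) (mem i' hi') h
    refine ⟨?_, ha, hb⟩
    have hst := Nat.cast_injective ((div_left_inj' (by positivity)).1 hst)
    split_ifs at hst <;> omega

theorem necklaceVert_zero (n : ℕ) (a b : Bool) :
    necklaceVert n 0 a b =
      (((levelZeroPos a b).1 : ℝ), ((levelZeroPos a b).2 : ℝ)) := by
  have : ((n + 1 : ℕ) : ℝ) ≠ 0 := by positivity
  simp only [necklaceVert, zero_ne_one, if_false, if_true, div_self this, segPoint_one, necklaceSeg]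

theorem necklaceVert_two (n : ℕ) (a b : Bool) :
    necklaceVert n 2 a b =
      (((levelTwoPos a b).1 : ℝ), ((levelTwoPos a b).2 : ℝ)) := by
  simp [necklaceVert, segPoint_zero, necklaceSeg]

theorem Bblock_add_three_planar (n k : ℕ) :
    IsPlanar ((wrappedButterfly (n + 3)).induce (Bblock (n + 3) k)) := by
  refine Bblock_planar_of_drawing (n := n + 1) (necklaceVert n)
    (fun _ _ _ _ _ _ hi hi' h => necklaceVert_injective hi hi' h) necklaceSeg
    (by decide) necklaceSeg_meet (fun c => if c.2.2 = none then n + 1 else 1) ?_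
  rintro i a b j a' b' hi (⟨rfl, rfl, rfl⟩ | ⟨rfl, rfl, rfl⟩ | ⟨h2, rfl, rfl, rfl⟩)
  · refine ⟨(a, b, some (false, a')), 0, by simp, ?_⟩
    rw [necklaceVert_zero]
    simp [segPoint_zero, segPoint_one, necklaceSeg, necklaceVert]
  · refine ⟨(a, b, some (true, b')), 0, by simp, ?_⟩
    rw [Nat.mod_eq_of_lt (by omega), necklaceVert_two]
    simp [segPoint_zero, segPoint_one, necklaceSeg, necklaceVert]
  · refine ⟨(a, b, none), i - 2, by simp; omega, ?_⟩
    have hnext : necklaceVert n ((i + 1) % (n + 1 + 2)) a b =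
        segPoint (necklaceSeg (a, b, none)) (((i - 2 : ℕ) + 1) / (n + 1 : ℕ)) := by
      rcases Nat.lt_or_ge (i + 1) (n + 1 + 2) with h | h
      · rw [Nat.mod_eq_of_lt h, necklaceVert, if_neg (by omega), if_neg (by omega),
          show i + 1 - 2 = (i - 2) + 1 by omega]
        push_cast
        rfl
      · obtain rfl : i = n + 2 := by omega
        simp [necklaceVert]
    rw [hnext, necklaceVert, if_neg (by omega), if_neg (by omega)]
    simp

end Drawings

/-- For `r ≥ 2`, each subgraph `B_k` of `WB(r)` (induced by the four consecutive
columns `4(k-1)+1, …, 4(k-1)+4`) is planar. -/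
theorem Bblock_planar (r : ℕ) (hr : 2 ≤ r) (k : ℕ) (hk : 1 ≤ k) (hk' : k ≤ 2 ^ (r - 2)) :
    IsPlanar ((wrappedButterfly r).induce (Bblock r k)) := by
  obtain rfl | hr := hr.eq_or_lt
  · exact Bblock_two_planar k
  · obtain ⟨n, rfl⟩ := Nat.exists_eq_add_of_le' hr
    exact Bblock_add_three_planar n k
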